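/- arXiv:2109.14939 — 2 statements merged into one kernel-verified Lean document; each statement's English description precedes it below -/
import Mathlib

section
/- If f: A → B is a ring epimorphism and A' is a ring Morita equivalent to A, then there exists a ring epimorphism f': A' → B' where B' is Morita equivalent to B. -/
universe u

open CategoryTheory

/-- `f : A → B` is an epimorphism in the category of rings. -/
def IsRingEpi {A B : Type u} [Ring A] [Ring B] (f : A →+* B) : Prop :=
  ∀ ⦃T : Type u⦄ [Ring T], ∀ g₁ g₂ : B →+* T, g₁.comp f = g₂.comp f → g₁ = g₂

open Limits

theorem restrictScalars_full_of_epi {R S : Type u} [Ring R] [Ring S] (f : R →+* S)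
    (hf : IsRingEpi f) : (ModuleCat.restrictScalars.{u} f).Full where
  map_surjective {M N} h := by
    let h0 : M →+ N := h.hom.toAddMonoidHom
    have hr : ∀ (r : R) (m : M), h0 (f r • m) = f r • h0 m := fun r m => h.hom.map_smul r m
    let g₁ : S →+* AddMonoid.End (M × N) := Module.toAddMonoidEnd S (M × N)
    let g₂ : S →+* AddMonoid.End (M × N) :=
      { toFun := fun s =>
          { toFun := fun p => (s • p.1, s • (p.2 - h0 p.1) + h0 (s • p.1))
            map_zero' := by simp
            map_add' := fun p q => by
              ext
              · simp
              · simp [smul_add, smul_sub]; abel }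
        map_one' := AddMonoidHom.ext fun p => Prod.ext
          (show (1 : S) • p.1 = p.1 by simp)
          (show (1 : S) • (p.2 - h0 p.1) + h0 ((1 : S) • p.1) = p.2 by simp)
        map_mul' := fun s t => AddMonoidHom.ext fun p => Prod.ext
          (show (s * t) • p.1 = s • t • p.1 by simp [mul_smul])
          (show (s * t) • (p.2 - h0 p.1) + h0 ((s * t) • p.1) =
            s • (t • (p.2 - h0 p.1) + h0 (t • p.1) - h0 (t • p.1)) + h0 (s • t • p.1) by
              simp [mul_smul])
        map_zero' := AddMonoidHom.ext fun p => Prod.ext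
          (show (0 : S) • p.1 = 0 by simp)
          (show (0 : S) • (p.2 - h0 p.1) + h0 ((0 : S) • p.1) = 0 by simp)
        map_add' := fun s t => AddMonoidHom.ext fun p => Prod.ext
          (show (s + t) • p.1 = s • p.1 + t • p.1 by simp [add_smul])
          (show (s + t) • (p.2 - h0 p.1) + h0 ((s + t) • p.1) =
            (s • (p.2 - h0 p.1) + h0 (s • p.1)) + (t • (p.2 - h0 p.1) + h0 (t • p.1)) by
              simp only [add_smul, map_add]; abel) }
    have hg : g₁ = g₂ := hf g₁ g₂ (RingHom.ext fun r => AddMonoidHom.ext fun p => Prod.ext rfl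
      (show f r • p.2 = f r • (p.2 - h0 p.1) + h0 (f r • p.1) by simp [hr, smul_sub]))
    have key : ∀ (s : S) (m : M), h0 (s • m) = s • h0 m := fun s m => by
      have : s • (0 : N) = s • (0 - h0 m) + h0 (s • m) :=
        congrArg Prod.snd (DFunLike.congr_fun (DFunLike.congr_fun hg s) (m, 0))
      rw [smul_zero, zero_sub, smul_neg] at this
      rw [neg_add_eq_sub, eq_comm, sub_eq_zero] at this
      exact this
    refine ⟨ModuleCat.ofHom { toFun := h0, map_add' := h0.map_add, map_smul' := key }, ?_⟩
    ext m
    rfl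

theorem isRingEpi_op {A B : Type u} [Ring A] [Ring B] (f : A →+* B) (hf : IsRingEpi f) :
    IsRingEpi (RingHom.op f) := by
  intro T _ g₁ g₂ h
  let k (g : Bᵐᵒᵖ →+* T) : B →+* Tᵐᵒᵖ :=
    { toFun := fun b => MulOpposite.op (g (MulOpposite.op b))
      map_one' := by simp
      map_mul' := by simp
      map_zero' := by simp
      map_add' := by simp }
  have := hf (k g₁) (k g₂) (by
    ext a
    exact congrArg MulOpposite.op (DFunLike.congr_fun h (MulOpposite.op a)))
  ext b
  exact MulOpposite.op_injective (DFunLike.congr_fun this b.unop)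

/-- converse of `restrictScalars_full_of_epi` -/
theorem isRingEpi_of_full {A B : Type u} [Ring A] [Ring B] (f : A →+* B)
    (hf : (ModuleCat.restrictScalars.{u} (RingHom.op f)).Full) : IsRingEpi f := by
  intro T _ g₁ g₂ h
  let M := (ModuleCat.restrictScalars (RingHom.op g₁)).obj (ModuleCat.of Tᵐᵒᵖ Tᵐᵒᵖ)
  let N := (ModuleCat.restrictScalars (RingHom.op g₂)).obj (ModuleCat.of Tᵐᵒᵖ Tᵐᵒᵖ)
  let i : (ModuleCat.restrictScalars.{u} (RingHom.op f)).obj M ⟶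
      (ModuleCat.restrictScalars.{u} (RingHom.op f)).obj N :=
    ModuleCat.ofHom (X := (ModuleCat.restrictScalars.{u} (RingHom.op f)).obj M)
      (Y := (ModuleCat.restrictScalars.{u} (RingHom.op f)).obj N)
      { toFun := fun x => (x : Tᵐᵒᵖ)
        map_add' := fun _ _ => rfl
        map_smul' := fun r x => by
          have := DFunLike.congr_fun h r.unop
          exact congrArg (fun t : T => MulOpposite.op t * (show Tᵐᵒᵖ from x)) this }
  obtain ⟨j, hj⟩ := hf.map_surjective i
  have hj' : ∀ x : Tᵐᵒᵖ, (j.hom x : Tᵐᵒᵖ) = x := fun x => 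
    congrArg (fun k => (k.hom x : Tᵐᵒᵖ)) hj
  ext b
  have h1 := j.hom.map_smul (MulOpposite.op b) (1 : Tᵐᵒᵖ)
  have h2 : (show Tᵐᵒᵖ from j.hom (MulOpposite.op (g₁ b) * (1 : Tᵐᵒᵖ))) =
      MulOpposite.op (g₂ b) * (show Tᵐᵒᵖ from j.hom (1 : Tᵐᵒᵖ)) := h1
  erw [hj', hj', mul_one, mul_one] at h2
  exact MulOpposite.op_injective h2

theorem closed_top {C : Type*} [Category.{u} C] [Abelian C] [HasColimits C] (G : C)
    (hG : IsSeparator G) (Q : ObjectProperty C) [Q.IsClosedUnderIsomorphisms]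
    (hQ : ∀ (J : Type u) [SmallCategory J], Q.IsClosedUnderColimitsOfShape J)
    (hQ' : Q.IsClosedUnderColimitsOfShape WalkingParallelPair)
    (h : Q G) (X : C) : Q X := by
  have key : ∀ Y : C, ∃ (Z : C) (p : Z ⟶ Y), Epi p ∧ Q Z := fun Y => by
    refine ⟨∐ (fun _ : G ⟶ Y => G), Sigma.desc (fun φ => φ), (isSeparator_iff_epi G).1 hG Y, ?_⟩
    have := hQ (Discrete (G ⟶ Y))
    exact Q.prop_colimit _ (fun _ => h)
  obtain ⟨Z, p, hp, hZ⟩ := key X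
  obtain ⟨W, q, hq, hW⟩ := key (kernel p)
  have i : cokernel (q ≫ kernel.ι p) ≅ X :=
    cokernelEpiComp q _ ≪≫ (cokernelIsCokernel _).coconePointUniqueUpToIso 
      (Abelian.epiIsCokernelOfKernel _ (kernelIsKernel p))
  refine Q.prop_of_iso i (Q.prop_colimit _ ?_)
  rintro (_ | _)
  · exact hW
  · exact hZ

section Main

set_option linter.unusedSectionVars false

variable {R : Type u} [Ring R] {C : Type (u + 1)} [Category.{u} C] [Abelian C]
  {L : ModuleCat.{u} Rᵐᵒᵖ ⥤ C} {G : C ⥤ ModuleCat.{u} Rᵐᵒᵖ} (adj : L ⊣ G) [L.Additive]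

/-- right multiplication -/
def rmulHom (a : R) : ModuleCat.of Rᵐᵒᵖ Rᵐᵒᵖ ⟶ ModuleCat.of Rᵐᵒᵖ Rᵐᵒᵖ :=
  ModuleCat.ofHom (LinearMap.toSpanSingleton Rᵐᵒᵖ Rᵐᵒᵖ (MulOpposite.op a))

variable (L) in
/-- the ring map `R → End (L R)` -/
def mapEnd : R →+* End (L.obj (ModuleCat.of Rᵐᵒᵖ Rᵐᵒᵖ)) where
  toFun a := L.map (rmulHom a)
  map_one' := by
    rw [End.one_def, ← L.map_id]
    congr 1
    ext
    simp [rmulHom]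
  map_mul' a b := by
    rw [End.mul_def, ← L.map_comp]
    congr 1
    ext
    simp [rmulHom]
  map_zero' := by
    rw [← L.map_zero]
    congr 1
    ext
    simp [rmulHom]
  map_add' a b := by
    rw [← L.map_add]
    congr 1
    ext
    simp [rmulHom]

/-- the comparison on components -/
noncomputable def compEquiv (M : C) :
    (L.obj (ModuleCat.of Rᵐᵒᵖ Rᵐᵒᵖ) ⟶ M) ≃ G.obj M :=
  (adj.homEquiv _ _).trans
    ((ModuleCat.homEquiv).trans (LinearMap.ringLmapEquivSelf Rᵐᵒᵖ ℕ (G.obj M)).toEquiv)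

theorem compEquiv_apply (M : C) (φ : L.obj (ModuleCat.of Rᵐᵒᵖ Rᵐᵒᵖ) ⟶ M) :
    compEquiv adj M φ = (adj.homEquiv _ _ φ).hom (1 : Rᵐᵒᵖ) := rfl

theorem compEquiv_add [G.Additive] (M : C) (x y : L.obj (ModuleCat.of Rᵐᵒᵖ Rᵐᵒᵖ) ⟶ M) :
    compEquiv adj M (x + y) = compEquiv adj M x + compEquiv adj M y := by
  simp only [compEquiv_apply, adj.homEquiv_unit, Functor.map_add, Preadditive.comp_add]
  rfl

theorem compEquiv_smul (M : C) (r : Rᵐᵒᵖ) (x : L.obj (ModuleCat.of Rᵐᵒᵖ Rᵐᵒᵖ) ⟶ M) :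
    compEquiv adj M (L.map (rmulHom r.unop) ≫ x) = r • compEquiv adj M x := by
  simp only [compEquiv_apply, adj.homEquiv_naturality_left]
  rw [← map_smul]
  simp [rmulHom]

theorem compEquiv_nat {M N : C} (g : M ⟶ N) (x : L.obj (ModuleCat.of Rᵐᵒᵖ Rᵐᵒᵖ) ⟶ M) :
    compEquiv adj N (x ≫ g) = (G.map g).hom (compEquiv adj M x) := by
  simp only [compEquiv_apply, adj.homEquiv_naturality_right]
  rfl

/-- isomorphisms of modules from bijections -/
def isoMk {R : Type u} [Ring R] (X Y : ModuleCat.{u} R) (e : X ≃ Y)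
    (h1 : ∀ x y, e (x + y) = e x + e y) (h2 : ∀ (r : R) x, e (r • x) = r • e x) : X ≅ Y :=
  LinearEquiv.toModuleIso { e with map_add' := h1, map_smul' := h2 }

/-- comparison -/
noncomputable def compIso [G.Additive] :
    preadditiveCoyonedaObj (L.obj (ModuleCat.of Rᵐᵒᵖ Rᵐᵒᵖ)) ⋙
      ModuleCat.restrictScalars (RingHom.op (mapEnd L)) ≅ G :=
  NatIso.ofComponents (fun M => isoMk _ _ (compEquiv adj M)
      (compEquiv_add adj M)
      (compEquiv_smul adj M))
    (fun {M N} g => by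
      ext x
      exact compEquiv_nat adj g x)

end Main

/-- If `f : A → B` is a ring epimorphism and `A'` is Morita equivalent to `A`
(their categories of right modules are equivalent), then there is a ring epimorphism
`f' : A' → B'` with `B'` Morita equivalent to `B`. -/
theorem stmt8 {A A' B : Type u} [Ring A] [Ring A'] [Ring B]
    (f : A →+* B) (hf : IsRingEpi f)
    (e : ModuleCat.{u} Aᵐᵒᵖ ≌ ModuleCat.{u} A'ᵐᵒᵖ) :
    ∃ (B' : RingCat.{u}) (f' : A' →+* B'),
      IsRingEpi f' ∧ Nonempty (ModuleCat.{u} Bᵐᵒᵖ ≌ ModuleCat.{u} ((B' : Type u)ᵐᵒᵖ)) := by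
  have hop := restrictScalars_full_of_epi _ (isRingEpi_op f hf)
  let G : ModuleCat.{u} Bᵐᵒᵖ ⥤ ModuleCat.{u} A'ᵐᵒᵖ :=
    ModuleCat.restrictScalars.{u} (RingHom.op f) ⋙ e.functor
  have : e.functor.Additive := e.functor.additive_of_preserves_binary_products
  have : PreservesLimits (ModuleCat.restrictScalars.{u} (RingHom.op f)) :=
    ⟨⟨inferInstance⟩⟩
  have : PreservesLimits G := inferInstance
  have : PreservesColimits G := inferInstance
  have : G.Full := inferInstance
  have : G.Faithful := inferInstance
  have : G.Additive := inferInstance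
  have : G.IsRightAdjoint :=
    isRightAdjoint_of_preservesLimits_of_isCoseparating.{u} (isCoseparator_coseparator _) _
  let L := G.leftAdjoint
  let adj : L ⊣ G := Adjunction.ofIsRightAdjoint G
  have : L.Additive := adj.left_adjoint_additive
  let P := L.obj (ModuleCat.of A'ᵐᵒᵖ A'ᵐᵒᵖ)
  let H := preadditiveCoyonedaObj P
  let Res := ModuleCat.restrictScalars.{u} (RingHom.op (mapEnd L))
  let i : H ⋙ Res ≅ G := compIso adj
  have hfaith : H.Faithful := by
    have : (H ⋙ Res).Faithful := Functor.Faithful.of_iso i.symm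
    exact Functor.Faithful.of_comp H Res
  have hP : IsSeparator P := (isSeparator_iff_faithful_preadditiveCoyonedaObj P).2 hfaith
  have hfull : H.Full := IsGrothendieckAbelian.GabrielPopescu.full P hP
  have hcol : ∀ (J : Type u) [SmallCategory J], PreservesColimitsOfShape J H := fun J _ => by
    have : PreservesColimitsOfShape J (H ⋙ Res) := preservesColimitsOfShape_of_natIso i.symm
    have : ReflectsColimitsOfShape J Res := reflectsColimitsOfShape_of_reflectsIsomorphisms
    exact preservesColimitsOfShape_of_reflects_of_preserves H Res
  have hcol' : PreservesColimitsOfShape WalkingParallelPair H := by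
    have : PreservesColimitsOfShape WalkingParallelPair (H ⋙ Res) :=
      preservesColimitsOfShape_of_natIso i.symm
    have : ReflectsColimitsOfShape WalkingParallelPair Res :=
      reflectsColimitsOfShape_of_reflectsIsomorphisms
    exact preservesColimitsOfShape_of_reflects_of_preserves H Res
  have hess : H.EssSurj := ⟨fun X => by
    refine closed_top _ (ModuleCat.isSeparator.{u} (End P)ᵐᵒᵖ) H.essImage
      (fun J _ => inferInstance) inferInstance (H.essImage.prop_of_iso ?_ (H.obj_mem_essImage P)) X
    exact (LinearEquiv.toModuleIso ((Shrink.linearEquiv (End P)ᵐᵒᵖ (End P)ᵐᵒᵖ).trans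
      (Preadditive.homSelfLinearEquivEndMulOpposite P).symm)).symm⟩
  have heq : H.IsEquivalence := {}
  refine ⟨RingCat.of (End P), mapEnd L, ?_, ⟨H.asEquivalence⟩⟩
  apply isRingEpi_of_full
  have : (H.inv ⋙ G).Full := inferInstance
  exact Functor.Full.of_iso ((Functor.isoWhiskerLeft H.inv i.symm) ≪≫
    (Functor.associator _ _ _).symm ≪≫ Functor.isoWhiskerRight H.asEquivalence.counitIso Res ≪≫
    Functor.leftUnitor Res)
end

section
/- Let k be a field, A a finite-dimensional k-algebra, and B a finite-dimensional right A-module such that the natural map f_B: A → End_k(B) is a ring epimorphism. Then B is a brick, i.e. End_A(B) ≅ k. -/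
universe u

open MulOpposite

/-- **Proposition 19, (ii) ⇒ (i), epimorphism part.** Let `k` be a field, `A` a
finite-dimensional `k`-algebra and `B ≠ 0` a finite-dimensional right `A`-module such that the
structure map `f_B : A → End_k(B)` is a ring epimorphism. Then `B` is a brick: every `A`-linear
endomorphism of `B` is a scalar. -/
theorem stmt12 {k A B : Type u} [Field k]
    [Ring A] [Algebra k A] [FiniteDimensional k A]
    [AddCommGroup B] [Module k B] [FiniteDimensional k B] [Nontrivial B]
    [Module Aᵐᵒᵖ B] [SMulCommClass Aᵐᵒᵖ k B]
    (hepi : IsRingEpi (Module.toModuleEnd k B : Aᵐᵒᵖ →+* Module.End k B)) :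
    ∀ φ : B →ₗ[Aᵐᵒᵖ] B, ∃ c : k, ∀ x : B, φ x = c • x := by
  intro φ
  let g₁ : Module.End k B →+* AddMonoid.End (B × B) :=
    { toFun := fun b => AddMonoidHom.mk' (fun p => (b p.1, b p.2)) (by intro p q; simp)
      map_one' := by ext p <;> rfl
      map_mul' := by intro b c; ext p <;> rfl
      map_zero' := by ext p <;> rfl
      map_add' := by intro b c; ext p <;> rfl }
  let g₂ : Module.End k B →+* AddMonoid.End (B × B) :=
    { toFun := fun b => AddMonoidHom.mk'
        (fun p => (b p.1 - b (φ p.2) + φ (b p.2), b p.2))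
        (by intro p q; ext <;> simp; abel)
      map_one' := by
        refine AddMonoidHom.ext fun p => ?_
        change (p.1 - φ p.2 + φ p.2, p.2) = p
        simp
      map_mul' := by
        intro b c
        refine AddMonoidHom.ext fun p => ?_
        change (b (c p.1) - b (c (φ p.2)) + φ (b (c p.2)), b (c p.2)) =
          (b (c p.1 - c (φ p.2) + φ (c p.2)) - b (φ (c p.2)) + φ (b (c p.2)), b (c p.2))
        simp
      map_zero' := by
        refine AddMonoidHom.ext fun p => ?_
        change ((0 : B) - 0 + φ 0, (0 : B)) = 0
        simp
      map_add' := by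
        intro b c
        refine AddMonoidHom.ext fun p => ?_
        change ((b p.1 + c p.1) - (b (φ p.2) + c (φ p.2)) + φ (b p.2 + c p.2), b p.2 + c p.2) =
          ((b p.1 - b (φ p.2) + φ (b p.2)) + (c p.1 - c (φ p.2) + φ (c p.2)), b p.2 + c p.2)
        rw [map_add]
        ext
        · simp only []
          abel
        · rfl }
  have h : g₁ = g₂ := by
    apply hepi
    ext1 a
    refine AddMonoidHom.ext fun p => ?_
    change (a • p.1, a • p.2) = (a • p.1 - a • (φ p.2) + φ (a • p.2), a • p.2)
    simp
  have comm : ∀ (b : Module.End k B) (y : B), φ (b y) = b (φ y) := by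
    intro b y
    have h1 : g₁ b (0, y) = g₂ b (0, y) := by rw [h]
    have h2 : (b 0, b y) = (b 0 - b (φ y) + φ (b y), b y) := h1
    have h3 := congrArg Prod.fst h2
    simp only [map_zero, zero_sub] at h3
    exact (neg_add_eq_zero.mp h3.symm).symm
  obtain ⟨x, hx⟩ := exists_ne (0 : B)
  obtain ⟨f, hf⟩ := Module.Projective.exists_dual_eq_one k hx
  refine ⟨f (φ x), fun y => ?_⟩
  have := comm (f.smulRight y) x
  simpa [hf] using this
end
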